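/- Let (R,m) be a complete Noetherian reduced local ring of prime characteristic p > 0, let a ⊆ R be an ideal of positive height, and let q ⊆ a be a reduction of a generated by l elements. Then τ(a^{l-1})·a = τ(a^{l-1})·q, and moreover τ(a^{l-1}) = τ(q^{l-1}). -/

import Mathlib

open scoped TensorProduct

universe u

variable (R : Type u) [CommRing R]

/-- `R°`: the set of elements of `R` not contained in any minimal prime ideal. -/
def Rcirc : Set R := {c : R | ∀ P ∈ minimalPrimes R, c ∉ P}

/-- The Frobenius power `I^{[q]}`: the ideal generated by the `q`-th powers of elements of `I`. -/
def frobPow (I : Ideal R) (q : ℕ) : Ideal R := Ideal.span ((fun x : R => x ^ q) '' (I : Set R))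

/-- The `a^t`-tight closure of an ideal `J`. -/
def tightClosure (p : ℕ) (a : Ideal R) (t : ℚ) (J : Ideal R) : Set R :=
  {z : R | ∃ c ∈ Rcirc R, ∃ e₀ : ℕ, ∀ e : ℕ, e₀ ≤ e →
    ∀ x ∈ a ^ ⌈t * (p : ℚ) ^ e⌉₊, c * z ^ p ^ e * x ∈ frobPow R J (p ^ e)}

/-- The generalized test ideal `τ(a^t) = ⋂_J (J : J^{*aᵗ})`. -/
def testIdeal (p : ℕ) (a : Ideal R) (t : ℚ) : Ideal R :=
  ⨅ J : Ideal R, Submodule.colon J (Ideal.span (tightClosure R p a t J))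

/-- `R` is F-finite: finitely generated over itself via the Frobenius endomorphism. -/
def FrobAlg (p e : ℕ) : Type u := R

instance : CommRing (FrobAlg R p e) := inferInstanceAs (CommRing R)

/-- The identity of `R`, viewed as a ring map `R →+* ᵉR`. -/
def FrobAlg.of (p e : ℕ) : R →+* FrobAlg R p e := RingHom.id R

noncomputable instance [ExpChar R p] : Algebra R (FrobAlg R p e) :=
  ((FrobAlg.of R p e).comp (iterateFrobenius R p e)).toAlgebra

/-- F-finiteness of `R`. -/
def IsFFinite (p : ℕ) [ExpChar R p] : Prop := Module.Finite R (FrobAlg R p 1)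

/-- `0^{*aᵗ}_M`, the `aᵗ`-tight closure of zero in a module `M`. -/
def moduleTC (p : ℕ) [ExpChar R p] (a : Ideal R) (t : ℚ)
    (M : Type u) [AddCommGroup M] [Module R M] : Set M :=
  {z : M | ∃ c ∈ Rcirc R, ∃ e₀ : ℕ, ∀ e : ℕ, e₀ ≤ e →
    ∀ x ∈ a ^ ⌈t * (p : ℚ) ^ e⌉₊,
      (FrobAlg.of R p e (c * x)) ⊗ₜ[R] z = (0 : TensorProduct R (FrobAlg R p e) M)}

/-- `τ̃(aᵗ) = Ann_R (0^{*aᵗ}_E)`. -/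
def tildeTau (p : ℕ) [ExpChar R p] (a : Ideal R) (t : ℚ)
    (E : Type u) [AddCommGroup E] [Module R E] : Ideal R :=
  (Submodule.span R (moduleTC R p a t E)).annihilator

/-- `E` is an injective hull of the `R`-module `M`. -/
def IsInjectiveHull (M : Type u) [AddCommGroup M] [Module R M]
    (E : Type u) [AddCommGroup E] [Module R E] : Prop :=
  Module.Injective R E ∧
    ∃ ι : M →ₗ[R] E, Function.Injective ι ∧
      ∀ N : Submodule R E, N ≠ ⊥ → N ⊓ LinearMap.range ι ≠ ⊥

/-- `d` is an `aᵗ`-test element. -/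
def IsTestElement (p : ℕ) [ExpChar R p] (a : Ideal R) (t : ℚ) (d : R) : Prop :=
  d ∈ Rcirc R ∧
    ∀ (M : Type u) [AddCommGroup M] [Module R M], Module.Finite R M →
      ∀ z : M, z ∈ moduleTC R p a t M ↔
        ∀ e : ℕ, ∀ x ∈ a ^ ⌈t * (p : ℚ) ^ e⌉₊,
          (FrobAlg.of R p e (d * x)) ⊗ₜ[R] z = (0 : TensorProduct R (FrobAlg R p e) M)


/-! ### Commutative algebra of complete local rings -/

/-- `I` is maximal among the ideals not containing `s`, and is primary to the maximal ideal. -/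
def IrrAt {A : Type*} [CommRing A] [IsLocalRing A] (I : Ideal A) (s : A) : Prop :=
  s ∉ I ∧ (∀ K : Ideal A, I < K → s ∈ K) ∧ ∃ n : ℕ, IsLocalRing.maximalIdeal A ^ n ≤ I

theorem closed_aux {A : Type*} [CommRing A] [IsLocalRing A] [IsNoetherianRing A]
    (J : Ideal A) (x : A) (h : ∀ n : ℕ, x ∈ J ⊔ IsLocalRing.maximalIdeal A ^ n) : x ∈ J := by
  have key := Ideal.iInf_pow_smul_eq_bot_of_isLocalRing (M := A ⧸ J)
    (IsLocalRing.maximalIdeal A) (IsLocalRing.maximalIdeal.isMaximal A).ne_top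
  have : (Submodule.Quotient.mk x : A ⧸ J) ∈
      (⨅ i : ℕ, IsLocalRing.maximalIdeal A ^ i • (⊤ : Submodule A (A ⧸ J))) := by
    rw [Submodule.mem_iInf]
    intro n
    obtain ⟨j, hj, y, hy, rfl⟩ := Submodule.mem_sup.1 (h n)
    have h1 : (Submodule.Quotient.mk (j + y) : A ⧸ J) = y • (Submodule.Quotient.mk (1 : A)) := by
      rw [← Submodule.Quotient.mk_smul, Submodule.Quotient.eq]
      simpa using hj
    rw [h1]
    exact Submodule.smul_mem_smul hy trivial
  rw [key, Submodule.mem_bot, Submodule.Quotient.mk_eq_zero] at this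
  exact this

theorem exists_irrAt {A : Type*} [CommRing A] [IsLocalRing A] [IsNoetherianRing A]
    (J : Ideal A) (x : A) (h : x ∉ J) : ∃ I : Ideal A, J ≤ I ∧ IrrAt I x := by
  have : ∃ n : ℕ, x ∉ J ⊔ IsLocalRing.maximalIdeal A ^ n := by
    by_contra hc
    push Not at hc
    exact h (closed_aux J x hc)
  obtain ⟨n, hn⟩ := this
  obtain ⟨I, ⟨hI1, hI2⟩, hmax⟩ := set_has_maximal_iff_noetherian.2 ‹IsNoetherianRing A›
    {I : Ideal A | J ⊔ IsLocalRing.maximalIdeal A ^ n ≤ I ∧ x ∉ I} ⟨_, le_rfl, hn⟩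
  refine ⟨I, le_sup_left.trans hI1, hI2, fun K hK => ?_, n, le_sup_right.trans hI1⟩
  by_contra hx
  exact hmax K ⟨hI1.trans hK.le, hx⟩ hK

theorem isArtinian_aux {A : Type*} [CommRing A] [IsLocalRing A] [IsNoetherianRing A]
    (I : Ideal A) (n : ℕ) (h : IsLocalRing.maximalIdeal A ^ n ≤ I) : IsArtinian A (A ⧸ I) := by
  by_cases hI : I = ⊤
  · subst hI
    have : Subsingleton (A ⧸ (⊤ : Ideal A)) := Ideal.Quotient.subsingleton_iff.2 rfl
    infer_instance
  have : Nontrivial (A ⧸ I) := Ideal.Quotient.nontrivial_iff.2 hI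
  have : IsLocalRing (A ⧸ I) := IsLocalRing.of_surjective' (Ideal.Quotient.mk I)
    Ideal.Quotient.mk_surjective
  have hA : IsArtinianRing (A ⧸ I) := by
    rw [isArtinianRing_iff_isNilpotent_maximalIdeal]
    refine ⟨n, ?_⟩
    have h1 : IsLocalRing.maximalIdeal (A ⧸ I) ≤
        (IsLocalRing.maximalIdeal A).map (Ideal.Quotient.mk I) := by
      intro y hy
      obtain ⟨x, rfl⟩ := Ideal.Quotient.mk_surjective y
      apply Ideal.mem_map_of_mem
      rw [IsLocalRing.mem_maximalIdeal] at hy ⊢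
      exact fun hu => hy (hu.map _)
    rw [Ideal.zero_eq_bot, eq_bot_iff]
    refine (Ideal.pow_right_mono h1 n).trans ?_
    rw [← Ideal.map_pow, ← eq_bot_iff, Ideal.map_eq_bot_iff_le_ker, Ideal.mk_ker]
    exact h
  exact isArtinian_of_surjective_algebraMap (R := A ⧸ I) (M := A ⧸ I) (S := A)
    Ideal.Quotient.mk_surjective

theorem chevalley {A : Type*} [CommRing A] [IsLocalRing A] [IsNoetherianRing A]
    [IsAdicComplete (IsLocalRing.maximalIdeal A) A] {ι : Type*} [Nonempty ι]
    (F : ι → Ideal A) (hF : ∀ i j, ∃ k, F k ≤ F i ∧ F k ≤ F j) (n : ℕ) :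
    ∃ i, F i ≤ (⨅ j, F j) ⊔ IsLocalRing.maximalIdeal A ^ n := by
  set m := IsLocalRing.maximalIdeal A with hm
  have h1 : ∀ k : ℕ, ∃ i, ∀ j, F i ≤ F j ⊔ m ^ k := by
    intro k
    have := isArtinian_aux (m ^ k) k le_rfl
    obtain ⟨_, ⟨i, rfl⟩, hi⟩ := IsArtinian.set_has_minimal
      (Set.range fun i => Submodule.map (m ^ k).mkQ (F i)) (Set.range_nonempty _)
    refine ⟨i, fun j => ?_⟩
    obtain ⟨l, hl1, hl2⟩ := hF i j
    have h2 : Submodule.map (m ^ k).mkQ (F i) ≤ Submodule.map (m ^ k).mkQ (F l) := by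
      by_contra hc
      exact hi _ ⟨l, rfl⟩ (lt_of_le_not_ge (Submodule.map_mono hl1) hc)
    rw [Submodule.map_le_iff_le_comap, Submodule.comap_map_mkQ] at h2
    rw [sup_comm]
    exact h2.trans (sup_le_sup_left hl2 _)
  choose i hi using h1
  refine ⟨i n, fun x hx => ?_⟩
  have step : ∀ t : ℕ, ∀ y : A, y ∈ F (i (n + t)) →
      ∃ z, z ∈ F (i (n + (t + 1))) ∧ y - z ∈ m ^ (n + t) := by
    intro t y hy
    obtain ⟨z, hz, w, hw, rfl⟩ := Submodule.mem_sup.1 (hi (n + t) (i (n + (t + 1))) hy)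
    exact ⟨z, hz, by simpa using hw⟩
  choose g hg1 hg2 using step
  let Y : ∀ t : ℕ, {y : A // y ∈ F (i (n + t))} := fun t =>
    Nat.rec ⟨x, hx⟩ (fun t y => ⟨g t y.1 y.2, hg1 t y.1 y.2⟩) t
  have hY : ∀ t, (Y t).1 - (Y (t + 1)).1 ∈ m ^ (n + t) := fun t => hg2 t _ _
  have hY2 : ∀ s t, (Y s).1 - (Y (s + t)).1 ∈ m ^ (n + s) := by
    intro s t
    induction t with
    | zero => simp
    | succ t ih =>
      have := add_mem ih (Ideal.pow_le_pow_right (by omega : n + s ≤ n + (s + t)) (hY (s + t)))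
      rw [sub_add_sub_cancel] at this
      exact this
  obtain ⟨L, hL⟩ := IsPrecomplete.prec (I := m) (M := A) inferInstance (f := fun t => (Y t).1) (by
    intro s t hst
    obtain ⟨t, rfl⟩ := Nat.exists_eq_add_of_le hst
    rw [SModEq.sub_mem, smul_eq_mul, Ideal.mul_top]
    exact Ideal.pow_le_pow_right (by omega) (hY2 s t))
  have hL' : ∀ t, (Y t).1 - L ∈ m ^ t := by
    intro t
    have := hL t
    rwa [SModEq.sub_mem, smul_eq_mul, Ideal.mul_top] at this
  have hLF : L ∈ ⨅ j, F j := by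
    rw [Submodule.mem_iInf]
    intro j
    apply closed_aux
    intro k
    have e : L = (Y k).1 - ((Y k).1 - L) := by ring
    rw [e]
    refine sub_mem ?_ (le_sup_right (a := F j) (hL' k))
    have h3 : m ^ (n + k) ≤ m ^ k := Ideal.pow_le_pow_right (by omega)
    exact (sup_le_sup_left h3 (F j) : _ ≤ _) (hi (n + k) j (Y k).2)
  have e : x = L + ((x - (Y n).1) + ((Y n).1 - L)) := by ring
  rw [e]
  refine Submodule.add_mem_sup hLF (add_mem ?_ (hL' n))
  have := hY2 0 n
  rw [zero_add] at this
  exact this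

theorem IrrAt.mul_mem {A : Type*} [CommRing A] [IsLocalRing A] {I : Ideal A} {s : A}
    (h : IrrAt I s) {r : A} (hr : r ∈ IsLocalRing.maximalIdeal A) : r * s ∈ I := by
  by_contra hc
  have h1 : I < I ⊔ Ideal.span {r * s} := by
    refine lt_of_le_of_ne le_sup_left fun he => hc ?_
    rw [he]
    exact le_sup_right (a := I) (Ideal.mem_span_singleton_self _)
  obtain ⟨i, hi, y, hy, e⟩ := Submodule.mem_sup.1 (h.2.1 _ h1)
  obtain ⟨b, rfl⟩ := Ideal.mem_span_singleton'.1 hy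
  have hu : IsUnit (1 - b * r) := by
    have hbr := Ideal.mul_mem_left _ b hr
    by_contra hn
    have := add_mem ((IsLocalRing.mem_maximalIdeal _).2 hn) hbr
    rw [sub_add_cancel] at this
    exact (IsLocalRing.mem_maximalIdeal _).1 this isUnit_one
  apply h.1
  rw [← Ideal.unit_mul_mem_iff_mem I hu]
  have : (1 - b * r) * s = i := by linear_combination e.symm
  rwa [this]

theorem IrrAt.soc {A : Type*} [CommRing A] [IsLocalRing A] {I : Ideal A} {s : A}
    (h : IrrAt I s) {y : A} (hy : ∀ r ∈ IsLocalRing.maximalIdeal A, r * y ∈ I) (hyI : y ∉ I) :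
    ∃ b, IsUnit b ∧ y - b * s ∈ I := by
  have h1 : I < I ⊔ Ideal.span {y} := by
    refine lt_of_le_of_ne le_sup_left fun he => hyI ?_
    rw [he]
    exact le_sup_right (a := I) (Ideal.mem_span_singleton_self _)
  obtain ⟨i, hi, z, hz, e⟩ := Submodule.mem_sup.1 (h.2.1 _ h1)
  obtain ⟨b, rfl⟩ := Ideal.mem_span_singleton'.1 hz
  have hu : IsUnit b := by
    by_contra hn
    exact h.1 (e ▸ add_mem hi (hy b ((IsLocalRing.mem_maximalIdeal _).2 hn)))
  obtain ⟨u, rfl⟩ := hu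
  refine ⟨↑u⁻¹, Units.isUnit _, ?_⟩
  have : y - ↑u⁻¹ * s = -(↑u⁻¹ * i) := by
    rw [← e, mul_add, ← mul_assoc, Units.inv_mul]; ring
  rw [this]
  exact neg_mem (Ideal.mul_mem_left _ _ hi)

theorem length_covBy {A : Type*} [CommRing A] {J K : Ideal A} (h : J ⋖ K) :
    Module.length A (A ⧸ J) = 1 + Module.length A (A ⧸ K) := by
  have hs := (covBy_iff_quot_is_simple h.le).1 h
  rw [← Module.length_eq_one (R := A) (M := K ⧸ Submodule.comap K.subtype J)]
  refine Module.length_eq_add_of_exact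
    (Submodule.mapQ (Submodule.comap K.subtype J) J K.subtype le_rfl)
    (Submodule.factor h.le) ?_ (Submodule.factor_surjective h.le) ?_
  · rw [← LinearMap.ker_eq_bot, Submodule.ker_mapQ]
    simp
  · rw [LinearMap.exact_iff]
    ext x
    obtain ⟨x, rfl⟩ := Submodule.Quotient.mk_surjective _ x
    constructor
    · intro hx
      have : x ∈ K := (Submodule.Quotient.mk_eq_zero K).1 hx
      exact ⟨Submodule.Quotient.mk ⟨x, this⟩, rfl⟩
    · rintro ⟨y, hy⟩
      obtain ⟨y, rfl⟩ := Submodule.Quotient.mk_surjective _ y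
      rw [← hy]
      exact (Submodule.Quotient.mk_eq_zero K).2 y.2

theorem length_mono {A : Type*} [CommRing A] {J K : Ideal A} (h : J ≤ K) :
    Module.length A (A ⧸ K) ≤ Module.length A (A ⧸ J) :=
  Module.length_le_of_surjective (Submodule.factor h) (Submodule.factor_surjective h)

theorem exists_covBy {A : Type*} [CommRing A] [IsLocalRing A] (J K : Ideal A) (h : J < K) (n : ℕ)
    (hn : IsLocalRing.maximalIdeal A ^ n ≤ J) :
    ∃ z ∈ K, z ∉ J ∧ (∀ r ∈ IsLocalRing.maximalIdeal A, r * z ∈ J) ∧ J ⋖ J ⊔ Ideal.span {z} := by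
  obtain ⟨z, hzK, hzJ, hz⟩ : ∃ z ∈ K, z ∉ J ∧ ∀ r ∈ IsLocalRing.maximalIdeal A, r * z ∈ J := by
    obtain ⟨x, hxK, hxJ⟩ := SetLike.exists_of_lt h
    by_contra! hc
    have : ∀ k : ℕ, ∃ y ∈ IsLocalRing.maximalIdeal A ^ k, y * x ∉ J := by
      intro k
      induction k with
      | zero => exact ⟨1, by simp, by simpa using hxJ⟩
      | succ k ih =>
        obtain ⟨y, hy, hyx⟩ := ih
        obtain ⟨r, hr, hr2⟩ := hc (y * x) (Ideal.mul_mem_left _ _ hxK) hyx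
        exact ⟨r * y, by rw [pow_succ']; exact Ideal.mul_mem_mul hr hy, by rwa [mul_assoc]⟩
    obtain ⟨y, hy, hyx⟩ := this n
    exact hyx (Ideal.mul_mem_right _ _ (hn hy))
  refine ⟨z, hzK, hzJ, hz, ?_, ?_⟩
  · refine lt_of_le_of_ne le_sup_left fun he => hzJ ?_
    rw [he]
    exact le_sup_right (a := J) (Ideal.mem_span_singleton_self _)
  · intro L hL1 hL2
    obtain ⟨k, hkL, hkJ⟩ := SetLike.exists_of_lt hL1
    obtain ⟨j, hj, w, hw, e⟩ := Submodule.mem_sup.1 (hL2.le hkL)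
    obtain ⟨b, rfl⟩ := Ideal.mem_span_singleton'.1 hw
    have hu : IsUnit b := by
      by_contra hn
      exact hkJ (e ▸ add_mem hj (hz b ((IsLocalRing.mem_maximalIdeal _).2 hn)))
    refine hL2.not_ge (sup_le hL1.le ?_)
    rw [Ideal.span_singleton_le_iff_mem, ← Ideal.unit_mul_mem_iff_mem L hu]
    have : b * z = k - j := by rw [← e]; ring
    rw [this]
    exact sub_mem hkL (hL1.le hj)

theorem IrrAt.length_colon {A : Type*} [CommRing A] [IsLocalRing A] {I : Ideal A} {s : A}
    (h : IrrAt I s) (J : Ideal A) (z : A)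
    (hz : ∀ r ∈ IsLocalRing.maximalIdeal A, r * z ∈ J) :
    Module.length A (A ⧸ I.colon ((J ⊔ Ideal.span {z} : Ideal A) : Set A)) ≤
      1 + Module.length A (A ⧸ I.colon (J : Set A)) := by
  set J' := J ⊔ Ideal.span {z} with hJ'
  have hle : I.colon (J' : Set A) ≤ I.colon (J : Set A) :=
    Submodule.colon_mono le_rfl (fun x hx => (le_sup_left : J ≤ J') hx)
  have hzJ' : z ∈ J' := le_sup_right (a := J) (Ideal.mem_span_singleton_self _)
  have hmem : ∀ r, r ∈ I.colon (J : Set A) → r * z ∈ I → r ∈ I.colon (J' : Set A) := by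
    intro r hr hrz
    rw [Submodule.mem_colon] at hr ⊢
    intro x hx
    obtain ⟨j, hj, w, hw, rfl⟩ := Submodule.mem_sup.1 hx
    obtain ⟨b, rfl⟩ := Ideal.mem_span_singleton'.1 hw
    have e : r • (j + b * z) = r • j + b * (r * z) := by simp only [smul_eq_mul]; ring
    rw [e]
    exact add_mem (hr j hj) (Ideal.mul_mem_left _ _ hrz)
  have hsoc : ∀ r, r ∈ I.colon (J : Set A) → ∀ t ∈ IsLocalRing.maximalIdeal A, t * (r * z) ∈ I := by
    intro r hr t ht
    have := Submodule.mem_colon.1 hr _ (hz t ht)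
    rw [smul_eq_mul] at this
    convert this using 1
    ring
  have hw : I.colon (J' : Set A) ⩿ I.colon (J : Set A) := by
    refine ⟨hle, fun K hK1 hK2 => ?_⟩
    obtain ⟨r2, hr2, hr2'⟩ := SetLike.exists_of_lt hK1
    refine hK2.not_ge fun r1 hr1 => ?_
    by_cases h1 : r1 * z ∈ I
    · exact hK1.le (hmem r1 hr1 h1)
    · have h2 : r2 * z ∉ I := fun hc => hr2' (hmem r2 (hK2.le hr2) hc)
      obtain ⟨b1, hb1, e1⟩ := h.soc (hsoc r1 hr1) h1
      obtain ⟨b2, hb2, e2⟩ := h.soc (hsoc r2 (hK2.le hr2)) h2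
      rw [← Ideal.unit_mul_mem_iff_mem K hb2]
      have e3 : b2 * r1 = (b2 * r1 - b1 * r2) + b1 * r2 := by ring
      rw [e3]
      refine add_mem (hK1.le (hmem _ ?_ ?_)) (Ideal.mul_mem_left _ _ hr2)
      · exact sub_mem (Ideal.mul_mem_left _ _ hr1) (Ideal.mul_mem_left _ _ (hK2.le hr2))
      · have e4 : (b2 * r1 - b1 * r2) * z = b2 * (r1 * z - b1 * s) - b1 * (r2 * z - b2 * s) := by
          ring
        rw [e4]
        exact sub_mem (Ideal.mul_mem_left _ _ e1) (Ideal.mul_mem_left _ _ e2)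
  rcases hw.eq_or_covBy with he | hc
  · rw [he]
    exact le_add_self
  · exact (length_covBy hc).le

theorem IrrAt.length_ineq {A : Type*} [CommRing A] [IsLocalRing A] [IsNoetherianRing A]
    {I : Ideal A} {s : A} (h : IrrAt I s) (K : Ideal A) (J : Ideal A) : I ≤ J → J ≤ K →
    Module.length A (A ⧸ I.colon (K : Set A)) + Module.length A (A ⧸ K) ≤
      Module.length A (A ⧸ I.colon (J : Set A)) + Module.length A (A ⧸ J) := by
  induction J using IsNoetherian.induction with
  | hgt J ih =>
  intro hIJ hJK
  rcases hJK.eq_or_lt with rfl | hlt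
  · exact le_rfl
  obtain ⟨n, hn⟩ := h.2.2
  obtain ⟨z, hzK, hzJ, hz, hcov⟩ := exists_covBy J K hlt n (hn.trans hIJ)
  refine (ih _ hcov.lt (hIJ.trans le_sup_left)
    (sup_le hJK ((Ideal.span_singleton_le_iff_mem _).2 hzK))).trans ?_
  rw [length_covBy hcov]
  refine (add_le_add_left (h.length_colon J z hz) _).trans (le_of_eq ?_)
  ring

theorem IrrAt.colon_colon {A : Type*} [CommRing A] [IsLocalRing A] [IsNoetherianRing A]
    {I : Ideal A} {s : A} (h : IrrAt I s) (J : Ideal A) (hIJ : I ≤ J) :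
    I.colon (I.colon (J : Set A) : Set A) = J := by
  obtain ⟨n, hn⟩ := h.2.2
  have hfin : ∀ J : Ideal A, I ≤ J → Module.length A (A ⧸ J) ≠ ⊤ := by
    intro J hJ
    have := isArtinian_aux J n (hn.trans hJ)
    exact Module.length_ne_top
  have heq : ∀ J : Ideal A, I ≤ J →
      Module.length A (A ⧸ I.colon (J : Set A)) + Module.length A (A ⧸ J) =
        Module.length A (A ⧸ I) := by
    intro J hJ
    have ht : Module.length A (A ⧸ (⊤ : Ideal A)) = 0 := by
      rw [Module.length_eq_zero_iff]
      exact Ideal.Quotient.subsingleton_iff.2 rfl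
    apply le_antisymm
    · have := h.length_ineq J I le_rfl hJ
      have e : I.colon (I : Set A) = ⊤ := by simp
      rwa [e, ht, zero_add] at this
    · have := h.length_ineq ⊤ J hJ le_top
      have e : I.colon ((⊤ : Ideal A) : Set A) = I := by simp
      rwa [e, ht, add_zero] at this
  have hC : I ≤ I.colon (J : Set A) := Ideal.le_colon
  have h1 := heq _ hIJ
  have h2 := heq _ hC
  have hle : J ≤ I.colon (I.colon (J : Set A) : Set A) := by
    intro x hx
    rw [Submodule.mem_colon]
    intro y hy
    have := Submodule.mem_colon.1 hy x hx
    rw [smul_eq_mul] at this ⊢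
    rwa [mul_comm]
  rcases hle.eq_or_lt with he | hlt
  · exact he.symm
  exfalso
  obtain ⟨z, hzK, hzJ, hz, hcov⟩ := exists_covBy _ _ hlt n (hn.trans hIJ)
  have h3 := length_mono (sup_le hle ((Ideal.span_singleton_le_iff_mem _).2 hzK))
  have h4 := length_covBy hcov
  have f1 := hfin _ hIJ
  have f2 := hfin _ hC
  have f3 := hfin _ (hIJ.trans (le_sup_left : J ≤ J ⊔ Ideal.span {z}))
  have f4 := hfin _ (hIJ.trans hle)
  have f5 := hfin _ le_rfl
  generalize Module.length A (A ⧸ J) = a1 at *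
  generalize Module.length A (A ⧸ I) = a2 at *
  generalize Module.length A (A ⧸ I.colon (J : Set A)) = a3 at *
  generalize Module.length A (A ⧸ I.colon (I.colon (J : Set A) : Set A)) = a4 at *
  generalize Module.length A (A ⧸ (J ⊔ Ideal.span {z})) = a5 at *
  lift a1 to ℕ using f1
  lift a2 to ℕ using f5
  lift a3 to ℕ using f2
  lift a4 to ℕ using f4
  lift a5 to ℕ using f3
  norm_cast at *
  omega

theorem IrrAt.exists_colon {A : Type*} [CommRing A] [IsLocalRing A] [IsNoetherianRing A]
    {I I' : Ideal A} {s s' : A} (h : IrrAt I s) (h' : IrrAt I' s') (hle : I' ≤ I) :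
    ∃ u, ∀ x, x ∈ I ↔ x * u ∈ I' := by
  have h1 := h'.colon_colon I hle
  have h2 : s ∉ I'.colon (I'.colon (I : Set A) : Set A) := by
    rw [h1]
    exact h.1
  rw [Submodule.mem_colon] at h2
  push Not at h2
  obtain ⟨u, hu, hsu⟩ := h2
  have hI : I ≤ I'.colon {u} := by
    intro x hx
    have := Submodule.mem_colon.1 hu x hx
    rw [Submodule.mem_colon_singleton]
    rw [smul_eq_mul] at this ⊢
    rwa [mul_comm]
  refine ⟨u, fun x => ⟨fun hx => by simpa using hI hx, fun hx => ?_⟩⟩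
  rcases hI.eq_or_lt with he | hlt
  · rw [he]
    simpa using hx
  · exact absurd (Submodule.mem_colon_singleton.1 (h.2.1 _ hlt)) hsu

theorem exists_chain {A : Type*} [CommRing A] [IsLocalRing A] [IsNoetherianRing A]
    (P : Ideal A) (hP : P.IsPrime) (x : A) (hx : x ∉ P)
    (hmax : ∀ K : Ideal A, P < K → ∃ k : ℕ, x ^ k ∈ K) :
    ∃ I : ℕ → Ideal A, (∀ t, P ≤ I t) ∧ (∀ t, IrrAt (I t) (x ^ t)) ∧ Antitone I ∧
      (⨅ t, I t) ≤ P := by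
  have step : ∀ (t : ℕ) (I : Ideal A), P ≤ I ∧ IrrAt I (x ^ t) →
      ∃ I' : Ideal A, (P ≤ I' ∧ IrrAt I' (x ^ (t + 1))) ∧ ∀ r, r ∈ I ↔ r * x ∈ I' := by
    rintro t I ⟨hPI, hI⟩
    have h1 : x ^ (t + 1) ∉ P ⊔ Ideal.span {x} * I := by
      intro hc
      obtain ⟨y, hy, z, hz, e⟩ := Submodule.mem_sup.1 hc
      obtain ⟨i, hi, rfl⟩ := Ideal.mem_span_singleton_mul.1 hz
      have : x * (x ^ t - i) ∈ P := by
        have e2 : x * (x ^ t - i) = y := by linear_combination -e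
        rwa [e2]
      have h2 := hPI ((hP.mem_or_mem this).resolve_left hx)
      have := add_mem h2 hi
      rw [sub_add_cancel] at this
      exact hI.1 this
    obtain ⟨I', hle, hI'⟩ := exists_irrAt _ _ h1
    refine ⟨I', ⟨le_sup_left.trans hle, hI'⟩, ?_⟩
    have h2 : I ≤ I'.colon {x} := by
      intro r hr
      rw [Submodule.mem_colon_singleton, smul_eq_mul, mul_comm]
      exact hle (le_sup_right (a := P) (Ideal.mul_mem_mul (Ideal.mem_span_singleton_self x) hr))
    intro r
    rcases h2.eq_or_lt with he | hlt
    · rw [he, Submodule.mem_colon_singleton, smul_eq_mul]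
    · have := hI.2.1 _ hlt
      rw [Submodule.mem_colon_singleton, smul_eq_mul, ← pow_succ] at this
      exact absurd this hI'.1
  choose! g hg1 hg2 using step
  obtain ⟨I0, hI0⟩ : ∃ I : Ideal A, P ≤ I ∧ IrrAt I (x ^ 0) :=
    exists_irrAt P _ (by rw [pow_zero]; exact fun h => hP.ne_top ((Ideal.eq_top_iff_one _).2 h))
  let I : ℕ → Ideal A := fun t => Nat.rec I0 (fun t J => g t J) t
  have hI : ∀ t, P ≤ I t ∧ IrrAt (I t) (x ^ t) := by
    intro t
    induction t with
    | zero => exact hI0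
    | succ t ih => exact hg1 t (I t) ih
  have hI2 : ∀ t r, r ∈ I t ↔ r * x ∈ I (t + 1) := fun t r => hg2 t (I t) (hI t) r
  refine ⟨I, fun t => (hI t).1, fun t => (hI t).2, ?_, ?_⟩
  · refine antitone_nat_of_succ_le fun t r hr => ?_
    exact (hI2 t r).2 (Ideal.mul_mem_right _ _ hr)
  · have hP' : P ≤ ⨅ t, I t := le_iInf fun t => (hI t).1
    rcases hP'.eq_or_lt with he | hlt
    · exact he.ge
    · exfalso
      obtain ⟨k, hk⟩ := hmax _ hlt
      exact (hI k).2.1 ((Submodule.mem_iInf _).1 hk k)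

theorem glue {A : Type*} [CommRing A] [IsLocalRing A] [IsNoetherianRing A]
    {ι : Type*} [Fintype ι] [DecidableEq ι] (P : ι → Ideal A) (hP : ∀ i, (P i).IsPrime)
    (c : ι → A) (hc1 : ∀ i, c i ∉ P i) (hc2 : ∀ i j, i ≠ j → c i ∈ P j)
    (I : ι → Ideal A) (w : ι → A) (hPI : ∀ i, P i ≤ I i) (hI : ∀ i, IrrAt (I i) (w i)) :
    ∃ (K : Ideal A) (s : A), IrrAt K s ∧ K ≤ ⨅ i, I i := by
  rcases isEmpty_or_nonempty ι with hι | ⟨⟨o⟩⟩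
  · obtain ⟨K, _, hK⟩ := exists_irrAt (⊥ : Ideal A) 1 (by simp)
    exact ⟨K, 1, hK, le_iInf fun i => hι.elim i⟩
  have hu : ∀ i a, a * w i ∈ I i → a ∈ IsLocalRing.maximalIdeal A := by
    intro i a ha
    rw [IsLocalRing.mem_maximalIdeal]
    intro hn
    exact (hI i).1 ((Ideal.unit_mul_mem_iff_mem _ hn).1 ha)
  -- the ideal generated by the relations
  let L : Ideal A :=
    { carrier := {r | ∃ j a : ι → A, (∀ i, j i ∈ I i) ∧
        (∑ i, a i) ∈ IsLocalRing.maximalIdeal A ∧ r = ∑ i, c i * (j i + a i * w i)}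
      add_mem' := by
        rintro r r' ⟨j, a, hj, ha, rfl⟩ ⟨j', a', hj', ha', rfl⟩
        refine ⟨j + j', a + a', fun i => add_mem (hj i) (hj' i), ?_, ?_⟩
        · simp only [Pi.add_apply, Finset.sum_add_distrib]
          exact add_mem ha ha'
        · rw [← Finset.sum_add_distrib]
          refine Finset.sum_congr rfl fun i _ => ?_
          simp only [Pi.add_apply]
          ring
      zero_mem' := ⟨0, 0, fun i => zero_mem _, by simp, by simp⟩
      smul_mem' := by
        rintro r x ⟨j, a, hj, ha, rfl⟩
        refine ⟨fun i => r * j i, fun i => r * a i, fun i => Ideal.mul_mem_left _ _ (hj i), ?_, ?_⟩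
        · rw [← Finset.mul_sum]
          exact Ideal.mul_mem_left _ _ ha
        · rw [smul_eq_mul, Finset.mul_sum]
          refine Finset.sum_congr rfl fun i _ => ?_
          ring }
  have hs : c o * w o ∉ L := by
    rintro ⟨j, a, hj, ha, e⟩
    have key : ∀ i, c o * w o - c i * (j i + a i * w i) ∈ P i := by
      intro i
      rw [e, ← Finset.add_sum_erase _ _ (Finset.mem_univ i), add_sub_cancel_left]
      exact sum_mem fun k hk => Ideal.mul_mem_right _ _ (hc2 k i (Finset.ne_of_mem_erase hk))
    have k1 : ∀ i, i ≠ o → a i ∈ IsLocalRing.maximalIdeal A := by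
      intro i hi
      have h1 : c i * (j i + a i * w i) ∈ P i := by
        have := sub_mem (Ideal.mul_mem_right (w o) _ (hc2 o i hi.symm)) (key i)
        rwa [sub_sub_cancel] at this
      have h2 := hPI i (((hP i).mem_or_mem h1).resolve_left (hc1 i))
      have := sub_mem h2 (hj i)
      rw [add_sub_cancel_left] at this
      exact hu i _ this
    have k2 : 1 - a o ∈ IsLocalRing.maximalIdeal A := by
      have h1 : c o * (w o - (j o + a o * w o)) ∈ P o := by
        rw [mul_sub]
        exact key o
      have h2 := hPI o (((hP o).mem_or_mem h1).resolve_left (hc1 o))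
      apply hu o
      have := add_mem h2 (hj o)
      convert this using 1
      ring
    have k3 : ∑ i ∈ Finset.univ.erase o, a i ∈ IsLocalRing.maximalIdeal A :=
      sum_mem fun i hi => k1 i (Finset.ne_of_mem_erase hi)
    rw [← Finset.add_sum_erase _ _ (Finset.mem_univ o)] at ha
    have k4 := add_mem k2 (sub_mem ha k3)
    have e5 : 1 - a o + (a o + ∑ i ∈ Finset.univ.erase o, a i - ∑ i ∈ Finset.univ.erase o, a i)
      = 1 := by ring
    rw [e5] at k4
    exact (IsLocalRing.mem_maximalIdeal _).1 k4 isUnit_one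
  obtain ⟨K, hLK, hK⟩ := exists_irrAt L _ hs
  refine ⟨K, _, hK, le_iInf fun i => ?_⟩
  have h1 : I i ≤ K.colon {c i} := by
    intro y hy
    rw [Submodule.mem_colon_singleton, smul_eq_mul]
    refine hLK ⟨Pi.single i y, 0, fun k => ?_, by simp, ?_⟩
    · by_cases hk : k = i
      · subst hk; simpa using hy
      · simp [hk]
    · rw [Finset.sum_eq_single i]
      · simp [mul_comm]
      · intro k _ hk; simp [hk]
      · simp
  have h2 : K ≤ K.colon {c i} := Ideal.le_colon
  rcases h1.eq_or_lt with he | hlt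
  · rw [he]; exact h2
  · exfalso
    have h3 := (hI i).2.1 _ hlt
    rw [Submodule.mem_colon_singleton, smul_eq_mul] at h3
    apply hK.1
    have h4 : c o * w o - w i * c i ∈ K := by
      refine hLK ⟨0, Pi.single o 1 - Pi.single i 1, fun k => zero_mem _, ?_, ?_⟩
      · simp
      · simp [mul_sub, Finset.sum_sub_distrib, Pi.single_apply, mul_comm]
    have := add_mem h4 h3
    rwa [sub_add_cancel] at this

theorem approx_gorenstein {A : Type*} [CommRing A] [IsLocalRing A] [IsNoetherianRing A]
    [IsReduced A] [IsAdicComplete (IsLocalRing.maximalIdeal A) A] (n : ℕ) :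
    ∃ (K : Ideal A) (s : A), IrrAt K s ∧ K ≤ IsLocalRing.maximalIdeal A ^ n := by
  classical
  let T : Set (Ideal A) := {P | P.IsPrime ∧ ∃ x, x ∉ P ∧ ∀ K : Ideal A, P < K → ∃ k : ℕ, x ^ k ∈ K}
  have hT : ∀ x : A, x ≠ 0 → ∃ P ∈ T, x ∉ P := by
    intro x hx
    have h0 : ∀ k : ℕ, x ^ k ∉ (⊥ : Ideal A) := by
      intro k hk
      exact hx (IsReduced.eq_zero x ⟨k, hk⟩)
    obtain ⟨P, hP, hmax⟩ := set_has_maximal_iff_noetherian.2 ‹IsNoetherianRing A›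
      {I : Ideal A | ∀ k : ℕ, x ^ k ∉ I} ⟨⊥, h0⟩
    have hxP : x ∉ P := by simpa using hP 1
    have hmax' : ∀ K : Ideal A, P < K → ∃ k : ℕ, x ^ k ∈ K := by
      intro K hK
      by_contra hc
      push Not at hc
      exact hmax K hc hK
    refine ⟨P, ⟨Ideal.isPrime_of_maximally_disjoint P (Submonoid.powers x) ?_ ?_, x, hxP, hmax'⟩,
      hxP⟩
    · rw [Set.disjoint_left]
      rintro _ h1 ⟨k, rfl⟩
      exact hP k h1
    · intro K hK hd
      obtain ⟨k, hk⟩ := hmax' K hK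
      exact Set.disjoint_left.1 hd hk ⟨k, rfl⟩
  obtain ⟨S, hS⟩ := chevalley (A := A) (ι := Finset T) (fun S => S.inf (fun P => P.1))
    (fun S S' => ⟨S ∪ S', Finset.inf_mono Finset.subset_union_left,
      Finset.inf_mono Finset.subset_union_right⟩) n
  have hbot : (⨅ S : Finset T, S.inf (fun P => P.1)) = ⊥ := by
    rw [eq_bot_iff]
    intro x hx
    by_contra h0
    obtain ⟨P, hP, hxP⟩ := hT x h0
    have := (Submodule.mem_iInf _).1 hx {⟨P, hP⟩}
    simp at this
    exact hxP this
  rw [hbot, bot_sup_eq] at hS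
  let S' : Finset T := S.filter (fun P => Minimal (· ∈ S) P)
  have hS' : S'.inf (fun P => P.1) ≤ S.inf (fun P => P.1) := by
    refine Finset.le_inf fun P hP => ?_
    obtain ⟨Q, hQP, hQ⟩ := S.finite_toSet.exists_le_minimal (Finset.mem_coe.2 hP)
    exact (Finset.inf_le (Finset.mem_filter.2 ⟨hQ.1, hQ⟩ : Q ∈ S')).trans hQP
  have hPr : ∀ i : S', (i.1.1).IsPrime := fun i => i.1.2.1
  have hc : ∀ i : S', ∃ c, c ∉ i.1.1 ∧ ∀ j : S', i ≠ j → c ∈ j.1.1 := by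
    intro i
    have h1 : ¬ (Finset.univ.erase i).inf (fun j : S' => j.1.1) ≤ i.1.1 := by
      rw [(hPr i).inf_le']
      rintro ⟨j, hj, hji⟩
      have hi := (Finset.mem_filter.1 i.2).2
      have hjS := (Finset.mem_filter.1 j.2).1
      have : i.1 ≤ j.1 := hi.2 hjS hji
      exact Finset.ne_of_mem_erase hj (Subtype.ext (le_antisymm hji this))
    obtain ⟨c, hc1, hc2⟩ := SetLike.not_le_iff_exists.1 h1
    refine ⟨c, hc2, fun j hj => ?_⟩
    exact (Finset.inf_le (f := fun j : S' => j.1.1)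
      (Finset.mem_erase.2 ⟨hj.symm, Finset.mem_univ j⟩)) hc1
  choose c hc1 hc2 using hc
  have hch := fun i : S' => exists_chain i.1.1 (hPr i) i.1.2.2.choose i.1.2.2.choose_spec.1
    i.1.2.2.choose_spec.2
  choose I hI1 hI2 hI3 hI4 using hch
  obtain ⟨t, ht⟩ := chevalley (A := A) (fun t : ℕ => ⨅ i : S', I i t)
    (fun s t => ⟨max s t, iInf_mono fun i => hI3 i (le_max_left _ _),
      iInf_mono fun i => hI3 i (le_max_right _ _)⟩) n
  obtain ⟨K, s, hK, hKle⟩ := glue (fun i : S' => i.1.1) hPr c hc1 hc2 (fun i => I i t) _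
    (fun i => hI1 i t) (fun i => hI2 i t)
  refine ⟨K, s, hK, hKle.trans (ht.trans (sup_le ?_ le_rfl))⟩
  refine le_trans ?_ (hS'.trans hS)
  refine Finset.le_inf fun P hP => ?_
  refine le_trans ?_ (hI4 ⟨P, hP⟩)
  exact iInf_mono fun t => iInf_le _ (⟨P, hP⟩ : S')

/-! ### Tight closure -/

theorem frobPow_mul_mem {A : Type*} [CommRing A] {I I' : Ideal A} {u : A}
    (h : ∀ x ∈ I, x * u ∈ I') (n : ℕ) {y : A} (hy : y ∈ frobPow A I n) :
    y * u ^ n ∈ frobPow A I' n := by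
  unfold frobPow at hy
  induction hy using Submodule.span_induction with
  | mem x hx =>
    obtain ⟨x, hx, rfl⟩ := hx
    refine Ideal.subset_span ⟨x * u, h x hx, ?_⟩
    simp only [mul_pow]
  | zero => simp
  | add x y _ _ hx hy => rw [add_mul]; exact add_mem hx hy
  | smul r x _ hx => rw [smul_eq_mul, mul_assoc]; exact Ideal.mul_mem_left _ _ hx

theorem Rcirc_mul {A : Type*} [CommRing A] {c d : A} (hc : c ∈ Rcirc A) (hd : d ∈ Rcirc A) :
    c * d ∈ Rcirc A := by
  intro P hP hcd
  exact (hP.1.1.mem_or_mem hcd).elim (hc P hP) (hd P hP)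

theorem Rcirc_one {A : Type*} [CommRing A] : (1 : A) ∈ Rcirc A :=
  fun P hP h1 => hP.1.1.ne_top ((Ideal.eq_top_iff_one _).2 h1)

theorem Rcirc_prod {A : Type*} [CommRing A] {ι : Type*} (s : Finset ι) (c : ι → A)
    (h : ∀ i ∈ s, c i ∈ Rcirc A) : ∏ i ∈ s, c i ∈ Rcirc A :=
  Finset.prod_induction c (· ∈ Rcirc A) (fun _ _ => Rcirc_mul) Rcirc_one h

theorem ceil_aux (k p e : ℕ) : ⌈((k : ℕ) : ℚ) * (p : ℚ) ^ e⌉₊ = k * p ^ e := by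
  have : ((k : ℕ) : ℚ) * (p : ℚ) ^ e = ((k * p ^ e : ℕ) : ℚ) := by push_cast; rfl
  rw [this, Nat.ceil_natCast]

theorem mem_tc_iff {A : Type*} [CommRing A] (p k : ℕ) (a J : Ideal A) (z : A) :
    z ∈ tightClosure A p a (k : ℚ) J ↔ ∃ c ∈ Rcirc A, ∃ e₀ : ℕ, ∀ e : ℕ, e₀ ≤ e →
    ∀ x ∈ a ^ (k * p ^ e), c * z ^ p ^ e * x ∈ frobPow A J (p ^ e) := by
  unfold tightClosure
  simp only [Set.mem_ofPred_eq, ceil_aux]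

theorem tc_mul {A : Type*} [CommRing A] (p k : ℕ) (a I I' : Ideal A) (u : A)
    (h : ∀ x ∈ I, x * u ∈ I') {z : A} (hz : z ∈ tightClosure A p a (k : ℚ) I) :
    z * u ∈ tightClosure A p a (k : ℚ) I' := by
  rw [mem_tc_iff] at *
  obtain ⟨c, hc, e₀, H⟩ := hz
  refine ⟨c, hc, e₀, fun e he x hx => ?_⟩
  have := frobPow_mul_mem h _ (H e he x hx)
  convert this using 1
  ring

/-- The tight closure as an ideal. -/
def tcIdeal {A : Type*} [CommRing A] (p k : ℕ) [Fact p.Prime] [CharP A p] (a I : Ideal A) :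
    Ideal A where
  carrier := tightClosure A p a (k : ℚ) I
  zero_mem' := by
    rw [mem_tc_iff]
    refine ⟨1, Rcirc_one, 0, fun e _ x _ => ?_⟩
    rw [zero_pow (pow_ne_zero _ (Fact.out : p.Prime).ne_zero)]
    simp
  add_mem' := by
    intro y z hy hz
    rw [mem_tc_iff] at *
    obtain ⟨c, hc, e₀, H⟩ := hy
    obtain ⟨c', hc', e₀', H'⟩ := hz
    refine ⟨c * c', Rcirc_mul hc hc', max e₀ e₀', fun e he x hx => ?_⟩
    have h1 := Ideal.mul_mem_left _ c' (H e (le_trans (le_max_left _ _) he) x hx)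
    have h2 := Ideal.mul_mem_left _ c (H' e (le_trans (le_max_right _ _) he) x hx)
    rw [add_pow_char_pow]
    convert add_mem h1 h2 using 1
    ring
  smul_mem' := by
    intro r z hz
    rw [smul_eq_mul, mul_comm]
    exact tc_mul p k a I I r (fun x hx => Ideal.mul_mem_right _ _ hx) hz

theorem mem_tcIdeal {A : Type*} [CommRing A] {p k : ℕ} [Fact p.Prime] [CharP A p] {a I : Ideal A}
    {z : A} : z ∈ tcIdeal p k a I ↔ z ∈ tightClosure A p a (k : ℚ) I := Iff.rfl

theorem span_tc {A : Type*} [CommRing A] (p k : ℕ) [Fact p.Prime] [CharP A p] (a I : Ideal A) :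
    Ideal.span (tightClosure A p a (k : ℚ) I) = tcIdeal p k a I :=
  Ideal.span_eq (tcIdeal p k a I)

theorem le_tcIdeal {A : Type*} [CommRing A] (p k : ℕ) [Fact p.Prime] [CharP A p] (a I : Ideal A) :
    I ≤ tcIdeal p k a I := by
  intro z hz
  rw [mem_tcIdeal, mem_tc_iff]
  refine ⟨1, Rcirc_one, 0, fun e _ x _ => ?_⟩
  rw [one_mul]
  exact Ideal.mul_mem_right _ _ (Ideal.subset_span ⟨z, hz, rfl⟩)

theorem exists_Rcirc {A : Type*} [CommRing A] [IsNoetherianRing A] (a : Ideal A)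
    (hht : ∀ P ∈ minimalPrimes A, ¬ a ≤ P) (n : ℕ) : ∃ d ∈ Rcirc A, d ∈ a ^ n := by
  by_contra! hc
  have h1 : ((a ^ n : Ideal A) : Set A) ⊆ ⋃ P ∈ minimalPrimes A, (P : Set A) := by
    intro d hd
    have : d ∉ Rcirc A := fun h => hc d h hd
    unfold Rcirc at this
    simp only [Set.mem_ofPred_eq, not_forall, not_not] at this
    obtain ⟨P, hP, hdP⟩ := this
    exact Set.mem_biUnion hP hdP
  have h2 := (Ideal.subset_union_prime_finite (f := fun P : Ideal A => P)
    (minimalPrimes.finite_of_isNoetherianRing A) ⊥ ⊥ (fun P hP _ _ => hP.1.1)).1 h1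
  obtain ⟨P, hP, hle⟩ := h2
  have := hP.1.1
  exact hht P hP (Ideal.IsPrime.le_of_pow_le (n := n) hle)

theorem red_pow {A : Type*} [CommRing A] {a q : Ideal A} {n : ℕ} (h : a ^ (n + 1) = q * a ^ n)
    (N : ℕ) : a ^ (n + N) = q ^ N * a ^ n := by
  induction N with
  | zero => simp
  | succ N ih =>
    rw [← add_assoc, pow_succ, ih, mul_assoc, ← pow_succ, h, pow_succ, mul_assoc]

theorem tc_reduction {A : Type*} [CommRing A] [IsNoetherianRing A] (p k : ℕ) (a q J : Ideal A)
    (hht : ∀ P ∈ minimalPrimes A, ¬ a ≤ P) (hqa : q ≤ a) (hred : ∃ n : ℕ, a ^ (n + 1) = q * a ^ n) :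
    tightClosure A p a (k : ℚ) J = tightClosure A p q (k : ℚ) J := by
  obtain ⟨n, hn⟩ := hred
  obtain ⟨d, hd, hdn⟩ := exists_Rcirc a hht n
  ext z
  rw [mem_tc_iff, mem_tc_iff]
  constructor
  · rintro ⟨c, hc, e₀, H⟩
    exact ⟨c, hc, e₀, fun e he x hx => H e he x (Ideal.pow_right_mono hqa _ hx)⟩
  · rintro ⟨c, hc, e₀, H⟩
    refine ⟨c * d, Rcirc_mul hc hd, e₀, fun e he x hx => ?_⟩
    have h1 : d * x ∈ q ^ (k * p ^ e) := by
      have h2 : d * x ∈ a ^ n * a ^ (k * p ^ e) := Ideal.mul_mem_mul hdn hx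
      have h3 : a ^ n * a ^ (k * p ^ e) ≤ q ^ (k * p ^ e) := by
        rw [← pow_add, red_pow hn (k * p ^ e)]
        exact Ideal.mul_le_left
      exact h3 h2
    convert H e he _ h1 using 1
    ring

open scoped Pointwise in
theorem pigeon {A : Type*} [CommRing A] (l Q : ℕ) (x : Fin (l + 1) → A) :
    Ideal.span (Set.range x) ^ ((l + 1) * Q) ≤
      ⨆ i, Ideal.span {x i ^ Q} * Ideal.span (Set.range x) ^ (l * Q) := by
  have h0 : Ideal.span (Set.range x) ^ ((l + 1) * Q) =
      Ideal.span (Set.range x ^ ((l + 1) * Q)) := Submodule.span_pow _ _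
  rw [h0, Ideal.span_le]
  intro y hy
  obtain ⟨f, rfl⟩ := Set.mem_pow.1 hy
  rw [List.prod_ofFn]
  have hf : ∀ j, ∃ i, x i = (f j : A) := fun j => (f j).2
  choose g hg using hf
  simp only [← hg]
  obtain ⟨i, _, hi⟩ := Finset.exists_le_card_fiber_of_mul_le_card_of_maps_to (n := Q)
    (s := Finset.univ) (t := Finset.univ) (f := g) (by simp) ⟨0, Finset.mem_univ _⟩
    (by simp)
  obtain ⟨s, hs, hcard⟩ := Finset.exists_subset_card_eq hi
  refine Submodule.mem_iSup_of_mem i ?_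
  rw [← Finset.prod_mul_prod_compl s]
  refine Ideal.mul_mem_mul ?_ ?_
  · rw [Finset.prod_congr rfl (g := fun _ => x i)
      (fun j hj => by rw [(Finset.mem_filter.1 (hs hj)).2]), Finset.prod_const, hcard]
    exact Ideal.mem_span_singleton_self _
  · have hc : sᶜ.card = l * Q := by
      rw [Finset.card_compl, hcard, Fintype.card_fin, add_mul, one_mul, Nat.add_sub_cancel]
    rw [← hc, ← Finset.prod_const]
    exact Ideal.prod_mem_prod fun j _ => Ideal.subset_span ⟨g j, rfl⟩

theorem tc_skoda {A : Type*} [CommRing A] [IsNoetherianRing A] (p l : ℕ) (a q J : Ideal A)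
    (hht : ∀ P ∈ minimalPrimes A, ¬ a ≤ P) (hqa : q ≤ a) (x : Fin (l + 1) → A)
    (hx : Ideal.span (Set.range x) = q) (hred : ∃ n : ℕ, a ^ (n + 1) = q * a ^ n)
    (z : A) (hz : ∀ y ∈ q, z * y ∈ tightClosure A p a (l : ℚ) J) :
    ∀ y ∈ a, z * y ∈ tightClosure A p a (l : ℚ) J := by
  intro y hy
  obtain ⟨n, hn⟩ := hred
  obtain ⟨d, hd, hdn⟩ := exists_Rcirc a hht n
  have h1 : ∀ i, z * x i ∈ tightClosure A p a (l : ℚ) J :=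
    fun i => hz _ (hx ▸ Ideal.subset_span ⟨i, rfl⟩)
  simp only [mem_tc_iff] at h1
  choose c hc e₀ H using h1
  rw [mem_tc_iff]
  refine ⟨(∏ i, c i) * d, Rcirc_mul (Rcirc_prod _ _ fun i _ => hc i) hd, Finset.univ.sup e₀,
    fun e he w hw => ?_⟩
  have h2 : d * (y ^ p ^ e * w) ∈ q ^ ((l + 1) * p ^ e) := by
    have h2 : d * (y ^ p ^ e * w) ∈ a ^ n * (a ^ (p ^ e) * a ^ (l * p ^ e)) :=
      Ideal.mul_mem_mul hdn (Ideal.mul_mem_mul (Ideal.pow_mem_pow hy (p ^ e)) hw)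
    have e1 : (l + 1) * p ^ e = p ^ e + l * p ^ e := by ring
    have h3 : a ^ n * (a ^ (p ^ e) * a ^ (l * p ^ e)) ≤ q ^ ((l + 1) * p ^ e) := by
      rw [← pow_add, ← pow_add, ← e1, red_pow hn ((l + 1) * p ^ e)]
      exact Ideal.mul_le_left
    exact h3 h2
  have h3 : q ^ ((l + 1) * p ^ e) ≤
      (frobPow A J (p ^ e)).colon {(∏ i, c i) * z ^ p ^ e} := by
    rw [← hx]
    refine (pigeon l (p ^ e) x).trans (iSup_le fun i => ?_)
    rw [Ideal.mul_le]
    intro r hr s hs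
    obtain ⟨b, rfl⟩ := Ideal.mem_span_singleton'.1 hr
    rw [Submodule.mem_colon_singleton, smul_eq_mul]
    rw [hx] at hs
    have h4 := H i e ((Finset.le_sup (Finset.mem_univ i)).trans he) s
      (Ideal.pow_right_mono hqa _ hs)
    have h5 := Ideal.mul_mem_left _ (b * ∏ j ∈ Finset.univ.erase i, c j) h4
    convert h5 using 1
    rw [← Finset.mul_prod_erase _ _ (Finset.mem_univ i)]
    ring
  have h6 := h3 h2
  rw [Submodule.mem_colon_singleton, smul_eq_mul] at h6
  convert h6 using 1
  ring

theorem skoda_main {A : Type*} [CommRing A]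
    (p : ℕ) [Fact p.Prime] [CharP A p]
    [IsNoetherianRing A] [IsReduced A] [IsLocalRing A]
    [IsAdicComplete (IsLocalRing.maximalIdeal A) A]
    (a : Ideal A) (hht : ∀ P ∈ minimalPrimes A, ¬ a ≤ P)
    (l : ℕ) (q : Ideal A) (hqa : q ≤ a) (x : Fin (l + 1) → A)
    (hx : Ideal.span (Set.range x) = q) (hred : ∃ n : ℕ, a ^ (n + 1) = q * a ^ n) :
    testIdeal A p a (l : ℚ) * a ≤ testIdeal A p a (l : ℚ) * q := by
  set τ := testIdeal A p a (l : ℚ) with hτ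
  have hτ1 : τ = ⨅ J : Ideal A, J.colon (tcIdeal p l a J : Set A) := by
    rw [hτ]
    unfold testIdeal
    simp only [span_tc]
  let ι := {I : Ideal A // ∃ s, IrrAt I s}
  let F : ι → Ideal A := fun I => I.1.colon (tcIdeal p l a I.1 : Set A)
  have hτ2 : τ = ⨅ I : ι, F I := by
    rw [hτ1]
    apply le_antisymm
    · exact le_iInf fun I => iInf_le _ I.1
    · refine le_iInf fun J r hr => ?_
      rw [Submodule.mem_colon]
      intro z hz
      by_contra hc
      obtain ⟨I, hJI, hI⟩ := exists_irrAt J _ hc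
      have h1 := Submodule.mem_colon.1 ((Submodule.mem_iInf _).1 hr (⟨I, _, hI⟩ : ι))
      refine hI.1 (h1 z ?_)
      have := tc_mul p l a J I 1 (fun x hx => by rw [mul_one]; exact hJI hx) hz
      rwa [mul_one] at this
  have hmono : ∀ I I' : ι, I'.1 ≤ I.1 → F I' ≤ F I := by
    rintro ⟨I, s, hI⟩ ⟨I', s', hI'⟩ hle r hr
    obtain ⟨u, hu⟩ := hI.exists_colon hI' hle
    refine Submodule.mem_colon.2 fun z hz => ?_
    have h1 := Submodule.mem_colon.1 hr (z * u) (tc_mul p l a I I' u (fun x hx => (hu x).1 hx) hz)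
    rw [smul_eq_mul] at h1 ⊢
    refine (hu _).2 ?_
    rwa [mul_assoc]
  have hsmall : ∀ (I : ι) (n : ℕ), ∃ I' : ι, I'.1 ≤ I.1 ∧
      I'.1 ≤ IsLocalRing.maximalIdeal A ^ n := by
    rintro ⟨I, s, hI⟩ n
    obtain ⟨k, hk⟩ := hI.2.2
    obtain ⟨K, s', hK, hle⟩ := approx_gorenstein (A := A) (max k n)
    exact ⟨⟨K, s', hK⟩, (hle.trans (Ideal.pow_le_pow_right (le_max_left _ _))).trans hk,
      hle.trans (Ideal.pow_le_pow_right (le_max_right _ _))⟩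
  have hne : Nonempty ι := by
    obtain ⟨K, s', hK, hle⟩ := approx_gorenstein (A := A) 0
    exact ⟨⟨K, s', hK⟩⟩
  have hdir : ∀ i j : ι, ∃ k, F k ≤ F i ∧ F k ≤ F j := by
    intro i j
    obtain ⟨n, hn⟩ := j.2.choose_spec.2.2
    obtain ⟨k, hk1, hk2⟩ := hsmall i n
    exact ⟨k, hmono _ _ hk1, hmono _ _ (hk2.trans hn)⟩
  intro y hy
  apply closed_aux
  intro n
  obtain ⟨I0, hI0⟩ := chevalley F hdir n
  rw [← hτ2] at hI0
  obtain ⟨I, hII0, hIn⟩ := hsmall I0 n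
  obtain ⟨s, hI⟩ := I.2
  have hFI : F I ≤ τ ⊔ IsLocalRing.maximalIdeal A ^ n := (hmono _ _ hII0).trans hI0
  have hτF : τ ≤ F I := hτ2.le.trans (iInf_le _ I)
  have hdual : I.1.colon (F I : Set A) = tcIdeal p l a I.1 :=
    hI.colon_colon _ (le_tcIdeal p l a I.1)
  have hkey : F I * a ≤ F I * q ⊔ I.1 := by
    rw [← hI.colon_colon (F I * q ⊔ I.1) le_sup_right, Ideal.mul_le]
    intro r hr b hb
    rw [Submodule.mem_colon]
    intro v hv
    have h1 : ∀ y ∈ q, v * y ∈ tightClosure A p a (l : ℚ) I.1 := by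
      intro y hy
      rw [← mem_tcIdeal (p := p), ← hdual, Submodule.mem_colon]
      intro t ht
      have := Submodule.mem_colon.1 hv (t * y)
        (le_sup_left (b := I.1) (Ideal.mul_mem_mul ht hy))
      rw [smul_eq_mul] at this ⊢
      convert this using 1
      ring
    have h2 := tc_skoda p l a q I.1 hht hqa x hx hred v h1 b hb
    have := Submodule.mem_colon.1 hr _ h2
    rw [smul_eq_mul] at this ⊢
    convert this using 1
    ring
  have h3 : F I * q ⊔ I.1 ≤ τ * q ⊔ IsLocalRing.maximalIdeal A ^ n := by
    refine sup_le ?_ (hIn.trans le_sup_right)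
    refine (Ideal.mul_mono_left hFI).trans ?_
    rw [Ideal.sup_mul]
    exact sup_le_sup_left Ideal.mul_le_left _
  exact h3 (hkey (Ideal.mul_mono_left hτF hy))

/-- **Remark 4.6** (Hara–Takagi).  `(R,m)` a complete Noetherian reduced local ring of
characteristic `p > 0`, `a` an ideal of positive height and `q ⊆ a` a reduction of `a`
generated by `l` elements.  Then `τ(a^{l-1})·a = τ(a^{l-1})·q` and `τ(a^{l-1}) = τ(q^{l-1})`. -/
theorem testIdeal_reduction
    (p : ℕ) [Fact p.Prime] [CharP R p]
    [IsNoetherianRing R] [IsReduced R] [IsLocalRing R]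
    [IsAdicComplete (IsLocalRing.maximalIdeal R) R]
    (a : Ideal R) (hht : ∀ P ∈ minimalPrimes R, ¬ a ≤ P)
    (l : ℕ) (q : Ideal R) (hqa : q ≤ a)
    (hgen : ∃ x : Fin l → R, Ideal.span (Set.range x) = q)
    (hred : ∃ n : ℕ, a ^ (n + 1) = q * a ^ n) :
    testIdeal R p a (((l - 1 : ℕ) : ℚ)) * a = testIdeal R p a (((l - 1 : ℕ) : ℚ)) * q ∧
    testIdeal R p a (((l - 1 : ℕ) : ℚ)) = testIdeal R p q (((l - 1 : ℕ) : ℚ)) := by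
  refine ⟨le_antisymm ?_ (Ideal.mul_mono_right hqa), ?_⟩
  · obtain ⟨x, hx⟩ := hgen
    rcases l with _ | l
    · exfalso
      have hq : q = ⊥ := by
        rw [← hx, Set.range_eq_empty, Ideal.span_empty]
      obtain ⟨n, hn⟩ := hred
      rw [hq, Ideal.bot_mul] at hn
      obtain ⟨P, hP⟩ := Ideal.nonempty_minimalPrimes (R := R) (I := ⊥) top_ne_bot.symm
      have := hP.1.1
      exact hht P hP (Ideal.IsPrime.le_of_pow_le (n := n + 1) (hn.trans_le bot_le))
    · exact skoda_main p a hht l q hqa x hx hred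
  · unfold testIdeal
    simp only [tc_reduction p (l - 1) a q _ hht hqa hred]
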